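/- Fix integers l ≥ 1 and e ≥ 2, let s ∈ S_e and let (λ,s) be cylindric, not FLOTW, and such that the width α of its first pseudoperiod P(λ) equals the largest part of λ (so that P(λ) is a period of the symbol). Then each of the e rightmost columns of the s-symbol B_s(λ) contains exactly one entry corresponding to a node of P(λ). -/

import Mathlib

namespace FockCrystal

/-- A partition: `part a` is the `a`-th part, for `a ≥ 1`; `part 0` is a dummy value `0`. -/
structure Partition where
  part : ℕ → ℕ
  part_zero : part 0 = 0
  antitone : ∀ a : ℕ, 1 ≤ a → part (a + 1) ≤ part a
  eventually_zero : ∃ N : ℕ, ∀ a : ℕ, N ≤ a → part a = 0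

/-- A multipartition with `l + 1` components. -/
abbrev MultiPartition (l : ℕ) := Fin (l + 1) → Partition

/-- A node `(a, b, c)`: row `a ≥ 1`, column `b ≥ 1`, component `c`. -/
structure Node (l : ℕ) where
  row : ℕ
  col : ℕ
  comp : Fin (l + 1)

variable {l : ℕ}

def IsNode (Λ : MultiPartition l) (γ : Node l) : Prop :=
  1 ≤ γ.row ∧ 1 ≤ γ.col ∧ γ.col ≤ (Λ γ.comp).part γ.row

/-- The content `b − a + s_c` of a node. -/
def content (s : Fin (l + 1) → ℤ) (γ : Node l) : ℤ :=
  (γ.col : ℤ) - (γ.row : ℤ) + s γ.comp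

/-- `γ` is a removable node of `Λ`. -/
def Removable (Λ : MultiPartition l) (γ : Node l) : Prop :=
  1 ≤ γ.row ∧ 1 ≤ γ.col ∧ γ.col = (Λ γ.comp).part γ.row ∧
    (Λ γ.comp).part (γ.row + 1) < (Λ γ.comp).part γ.row

/-- `γ` is an addable node of `Λ`. -/
def Addable (Λ : MultiPartition l) (γ : Node l) : Prop :=
  1 ≤ γ.row ∧ γ.col = (Λ γ.comp).part γ.row + 1 ∧
    (γ.row = 1 ∨ (Λ γ.comp).part γ.row < (Λ γ.comp).part (γ.row - 1))

/-- The strict order `≺_s` on nodes. -/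
def NodeLt (s : Fin (l + 1) → ℤ) (γ γ' : Node l) : Prop :=
  content s γ < content s γ' ∨ (content s γ = content s γ' ∧ γ'.comp < γ.comp)

inductive Letter | A | R
  deriving DecidableEq

/-- The letter attached to a node is `A` iff the node is addable, `R` iff removable. -/
def LetterOk (Λ : MultiPartition l) (p : Node l × Letter) : Prop :=
  (p.2 = Letter.A ↔ Addable Λ p.1) ∧ (p.2 = Letter.R ↔ Removable Λ p.1)

/-- `w` is the `i`-word of `(Λ, s)` for the residue-mod-`e` structure: the list of
addable/removable nodes of residue `i`, in increasing `≺_s`-order, with letters A/R. -/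
def IsWordE (Λ : MultiPartition l) (s : Fin (l + 1) → ℤ) (e : ℕ) (i : ℤ)
    (w : List (Node l × Letter)) : Prop :=
  w.Pairwise (fun p q => NodeLt s p.1 q.1) ∧
  (∀ γ : Node l, (∃ x, (γ, x) ∈ w) ↔
      ((Addable Λ γ ∨ Removable Λ γ) ∧ content s γ % (e : ℤ) = i)) ∧
  ∀ p ∈ w, LetterOk Λ p

/-- `w` is the `j`-word of `(Λ, s)` for the `e = ∞` structure: the list of
addable/removable nodes of content `j`, in increasing `≺_s`-order, with letters A/R. -/
def IsWordInf (Λ : MultiPartition l) (s : Fin (l + 1) → ℤ) (j : ℤ)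
    (w : List (Node l × Letter)) : Prop :=
  w.Pairwise (fun p q => NodeLt s p.1 q.1) ∧
  (∀ γ : Node l, (∃ x, (γ, x) ∈ w) ↔
      ((Addable Λ γ ∨ Removable Λ γ) ∧ content s γ = j)) ∧
  ∀ p ∈ w, LetterOk Λ p

/-- Recursive cancellation of all factors `RA` in a word (of nodes with letters). -/
def reduceW : List (Node l × Letter) → List (Node l × Letter)
  | [] => []
  | p :: ps =>
    match reduceW ps with
    | [] => [p]
    | q :: qs => if p.2 = Letter.R ∧ q.2 = Letter.A then qs else p :: q :: qs

/-- `γ` is the node encoded by the rightmost `A` of the reduced word of `w`. -/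
def GoodAddableWord (w : List (Node l × Letter)) (γ : Node l) : Prop :=
  ∃ u v, reduceW w = u ++ (γ, Letter.A) :: v ∧ ∀ p ∈ v, p.2 = Letter.R

/-- `γ` is the node encoded by the leftmost `R` of the reduced word of `w`. -/
def GoodRemovableWord (w : List (Node l × Letter)) (γ : Node l) : Prop :=
  ∃ u v, reduceW w = u ++ (γ, Letter.R) :: v ∧ ∀ p ∈ u, p.2 = Letter.A

/-- `γ` is the good addable `i`-node of `(Λ, s)` for the residue-mod-`e` structure. -/
def GoodAddable (Λ : MultiPartition l) (s : Fin (l + 1) → ℤ) (e : ℕ) (i : ℤ)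
    (γ : Node l) : Prop :=
  ∃ w, IsWordE Λ s e i w ∧ GoodAddableWord w γ

/-- `γ` is the good removable `i`-node of `(Λ, s)` for the residue-mod-`e` structure. -/
def GoodRemovable (Λ : MultiPartition l) (s : Fin (l + 1) → ℤ) (e : ℕ) (i : ℤ)
    (γ : Node l) : Prop :=
  ∃ w, IsWordE Λ s e i w ∧ GoodRemovableWord w γ

/-- `γ` is the good addable `j`-node of `(Λ, s)` for the `e = ∞` structure. -/
def GoodAddableInf (Λ : MultiPartition l) (s : Fin (l + 1) → ℤ) (j : ℤ)
    (γ : Node l) : Prop :=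
  ∃ w, IsWordInf Λ s j w ∧ GoodAddableWord w γ

/-- `Λ'` is obtained from `Λ` by adding the node `γ`. -/
def AddNode (Λ Λ' : MultiPartition l) (γ : Node l) : Prop :=
  (Λ' γ.comp).part γ.row = (Λ γ.comp).part γ.row + 1 ∧
  (∀ a : ℕ, a ≠ γ.row → (Λ' γ.comp).part a = (Λ γ.comp).part a) ∧
  ∀ c, c ≠ γ.comp → Λ' c = Λ c

/-- `s ∈ S_e`: `0 ≤ s_c − s_{c'} < e` whenever `c' < c`. -/
def InSe (e : ℕ) (s : Fin (l + 1) → ℤ) : Prop :=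
  ∀ c' c : Fin (l + 1), c' < c → 0 ≤ s c - s c' ∧ s c - s c' < (e : ℤ)

/-- `s ∈ D_e`: `0 ≤ s_1 ≤ … ≤ s_l < e`. -/
def InDe (e : ℕ) (s : Fin (l + 1) → ℤ) : Prop :=
  (∀ c, 0 ≤ s c ∧ s c < (e : ℤ)) ∧ Monotone s

/-- The rotation `c ↦ c + 1` of components. -/
def rho (l : ℕ) : Equiv.Perm (Fin (l + 1)) := finRotate (l + 1)

/-- The cyclage on multicharges: `ξ(s) = (s_l − e, s_1, …, s_{l−1})`. -/
def xiCharge (e : ℕ) (s : Fin (l + 1) → ℤ) : Fin (l + 1) → ℤ :=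
  fun c => s ((rho l).symm c) - if c = 0 then (e : ℤ) else 0

/-- The cyclage on multipartitions: `ξ(λ) = (λ^l, λ^1, …, λ^{l−1})`. -/
def xiMP (Λ : MultiPartition l) : MultiPartition l := fun c => Λ ((rho l).symm c)

/-- The corresponding bijection on nodes: `(a,b,c) ↦ (a,b,c+1)` cyclically. -/
def xiNode (γ : Node l) : Node l := ⟨γ.row, γ.col, rho l γ.comp⟩

/-- The component preceding `c` (cyclically). -/
def prevComp {l : ℕ} (c : Fin (l + 1)) : Fin (l + 1) := (rho l).symm c

/-- `(Λ, s)` is cylindric. -/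
def Cylindric (e : ℕ) (s : Fin (l + 1) → ℤ) (Λ : MultiPartition l) : Prop :=
  (∀ c : Fin l, ∀ a : ℕ, 1 ≤ a →
      (Λ c.succ).part (a + (s c.succ - s c.castSucc).toNat) ≤ (Λ c.castSucc).part a) ∧
  ∀ a : ℕ, 1 ≤ a →
      (Λ 0).part (a + ((e : ℤ) + s 0 - s (Fin.last l)).toNat) ≤ (Λ (Fin.last l)).part a

/-- `γ` is the rightmost node of a part of `Λ` of size `α`. -/
def RightmostAt (Λ : MultiPartition l) (α : ℕ) (γ : Node l) : Prop :=
  1 ≤ γ.row ∧ γ.col = α ∧ (Λ γ.comp).part γ.row = α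

/-- The residues of the rightmost nodes of the parts of size `α` cover `{0,…,e−1}`. -/
def Covers (e : ℕ) (s : Fin (l + 1) → ℤ) (Λ : MultiPartition l) (α : ℕ) : Prop :=
  ∀ r : ℤ, 0 ≤ r → r < (e : ℤ) →
    ∃ γ : Node l, RightmostAt Λ α γ ∧ content s γ % (e : ℤ) = r

/-- `(Λ, s)` is FLOTW. -/
def FLOTW (e : ℕ) (s : Fin (l + 1) → ℤ) (Λ : MultiPartition l) : Prop :=
  Cylindric e s Λ ∧ ∀ α : ℕ, 1 ≤ α → ¬ Covers e s Λ α

/-- `P 0, …, P (e−1)` is the first pseudoperiod of `(Λ, s)`, of width `α`. -/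
def IsFirstPseudoperiod (e : ℕ) (s : Fin (l + 1) → ℤ) (Λ : MultiPartition l)
    (α : ℕ) (P : ℕ → Node l) : Prop :=
  1 ≤ α ∧ Covers e s Λ α ∧ (∀ β : ℕ, α < β → ¬ Covers e s Λ β) ∧
  (∀ i, i < e → RightmostAt Λ α (P i)) ∧
  (∀ γ, RightmostAt Λ α γ → content s γ ≤ content s (P 0)) ∧
  (∀ γ, RightmostAt Λ α γ → content s γ = content s (P 0) → (P 0).comp ≤ γ.comp) ∧
  ∀ i : ℕ, i + 1 < e →
    content s (P (i + 1)) < content s (P i) ∧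
    (∀ γ, RightmostAt Λ α γ → content s γ < content s (P i) →
        content s γ ≤ content s (P (i + 1))) ∧
    ∀ γ, RightmostAt Λ α γ → content s γ = content s (P (i + 1)) →
        (P (i + 1)).comp ≤ γ.comp

/-- `γ` is one of the nodes of the pseudoperiod `P` (of length `e`). -/
def InPseudo (e : ℕ) (P : ℕ → Node l) (γ : Node l) : Prop := ∃ i, i < e ∧ P i = γ

/-- The number of parts of `π` equal to `v`. -/
noncomputable def countParts (π : Partition) (v : ℕ) : ℕ :=
  Nat.card {a : ℕ // 1 ≤ a ∧ π.part a = v}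

/-- `N^{>α}_c`: the number of parts of `Λ^c` greater than `α`. -/
noncomputable def NgtA (Λ : MultiPartition l) (α : ℕ) (c : Fin (l + 1)) : ℕ :=
  Nat.card {a : ℕ // 1 ≤ a ∧ α < (Λ c).part a}

/-- `N^α_c`: the number of parts of `Λ^c` (equal to `α`) whose rightmost node is in `P`. -/
noncomputable def NalP (e : ℕ) (P : ℕ → Node l) (c : Fin (l + 1)) : ℕ :=
  Nat.card {i : ℕ // i < e ∧ (P i).comp = c}

/-- The number of rows of component `c` above row `r` whose rightmost node is in `P`. -/
noncomputable def PAbove (e : ℕ) (P : ℕ → Node l) (c : Fin (l + 1)) (r : ℕ) : ℕ :=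
  Nat.card {i : ℕ // i < e ∧ (P i).comp = c ∧ (P i).row < r}

/-- `μ = ψ(Λ)`: for each component `C`, `μ^C` consists of the parts of `Λ^C` smaller
than `α`, the parts of `Λ^C` equal to `α` whose rightmost node is not in `P`, and the
parts of `Λ^{C−1}` (cyclically) greater than `α`; specified via part multiplicities. -/
def IsPsi (e : ℕ) (P : ℕ → Node l) (α : ℕ) (Λ μ : MultiPartition l) : Prop :=
  ∀ C : Fin (l + 1), ∀ v : ℕ, 1 ≤ v →
    countParts (μ C) v =
      if v < α then countParts (Λ C) v
      else if v = α then countParts (Λ C) α - NalP e P C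
      else countParts (Λ (prevComp C)) v

/-- The canonical association between nodes of `Λ` (outside the rows of `P`) and
nodes of `ψ(Λ)`: boxes of parts `> α` keep their row and move one component up
(cyclically), boxes of kept parts `≤ α` stay in their component, their row being
shifted by the number of rows removed above minus the number of rows inserted above. -/
def CanonAssoc (e : ℕ) (Λ : MultiPartition l) (α : ℕ) (P : ℕ → Node l)
    (γ Γ : Node l) : Prop :=
  Γ.col = γ.col ∧
  ( (α < (Λ γ.comp).part γ.row ∧ Γ.comp = rho l γ.comp ∧ Γ.row = γ.row)
  ∨ ((Λ γ.comp).part γ.row ≤ α ∧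
      (∀ i, i < e → ¬ ((P i).comp = γ.comp ∧ (P i).row = γ.row)) ∧
      Γ.comp = γ.comp ∧
      Γ.row + NgtA Λ α γ.comp + PAbove e P γ.comp γ.row
        = γ.row + NgtA Λ α (prevComp γ.comp)) )

/-- The entry of the `s`-symbol of `Λ` of size `p` in row `c` and column `k`
(`1 ≤ k ≤ p + s_c`): `b^c_a = λ^c_a − a + p + s_c` with `a = p + s_c − k + 1`. -/
def symbolEntry (s : Fin (l + 1) → ℤ) (Λ : MultiPartition l) (p : ℤ)
    (c : Fin (l + 1)) (k : ℕ) : ℤ :=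
  ((Λ c).part (p + s c - (k : ℤ) + 1).toNat : ℤ) - (p + s c - (k : ℤ) + 1) + p + s c

/-- `p` is an admissible size for the `s`-symbol of `Λ`:
`p ≥ 1 − s_c + h(λ^c)` for all `c`. -/
def SizeOK (s : Fin (l + 1) → ℤ) (Λ : MultiPartition l) (p : ℤ) : Prop :=
  ∀ c, 1 ≤ p + s c ∧ ∀ a : ℕ, p + s c ≤ (a : ℤ) → (Λ c).part a = 0

/-- The `s`-symbol of `Λ` of size `p` is semistandard: `s` is non-decreasing, the
entries in each column are non-decreasing (read from the row with the larger index
down to the row with the smaller one), and the entries in each row are increasing. -/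
def SemistandardAt (s : Fin (l + 1) → ℤ) (Λ : MultiPartition l) (p : ℤ) : Prop :=
  Monotone s ∧
  (∀ c c' : Fin (l + 1), c < c' → ∀ k : ℕ, 1 ≤ k → (k : ℤ) ≤ p + s c →
      symbolEntry s Λ p c' k ≤ symbolEntry s Λ p c k) ∧
  ∀ c, ∀ k : ℕ, 1 ≤ k → (k : ℤ) + 1 ≤ p + s c →
      symbolEntry s Λ p c k < symbolEntry s Λ p c (k + 1)

/-- The `s`-symbol of `Λ` is semistandard (for every admissible size). -/
def Semistandard (s : Fin (l + 1) → ℤ) (Λ : MultiPartition l) : Prop :=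
  ∀ p : ℤ, SizeOK s Λ p → SemistandardAt s Λ p

/-- The index of the column of the symbol of size `p` containing the entry
corresponding to the node `γ`. -/
def colOf (s : Fin (l + 1) → ℤ) (p : ℤ) (γ : Node l) : ℤ :=
  p + s γ.comp - (γ.row : ℤ) + 1


theorem Partition.part_le_of_le (π : Partition) {a b : ℕ} (ha : 1 ≤ a) (hab : a ≤ b) :
    π.part b ≤ π.part a := by
  induction b, hab using Nat.le_induction with
  | base => exact le_rfl
  | succ b hb ih => exact (π.antitone b (ha.trans hb)).trans ih

theorem InSe.zero_le {l e : ℕ} {s : Fin (l + 1) → ℤ} (hs : InSe e s) (c : Fin (l + 1)) :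
    s 0 ≤ s c := by
  rcases eq_or_ne c 0 with rfl | hc
  · exact le_rfl
  · linarith [(hs 0 c (Fin.pos_iff_ne_zero.2 hc)).1]

theorem InSe.le_last {l e : ℕ} {s : Fin (l + 1) → ℤ} (hs : InSe e s) (c : Fin (l + 1)) :
    s c ≤ s (Fin.last l) := by
  rcases eq_or_ne c (Fin.last l) with rfl | hc
  · exact le_rfl
  · linarith [(hs c (Fin.last l) (Fin.lt_last_iff_ne_last.2 hc)).1]

theorem InSe.last_lt {l e : ℕ} {s : Fin (l + 1) → ℤ} (hs : InSe e s) (he : 0 < e) :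
    s (Fin.last l) < s 0 + e := by
  rcases eq_or_ne (Fin.last l) 0 with h | h
  · rw [h]; omega
  · linarith [(hs 0 (Fin.last l) (Fin.pos_iff_ne_zero.2 h)).2]

theorem Cylindric.part_add_le_zero {l e : ℕ} {s : Fin (l + 1) → ℤ} {Λ : MultiPartition l}
    (hs : InSe e s) (hcyl : Cylindric e s Λ) (c : Fin (l + 1)) {a : ℕ} (ha : 1 ≤ a) :
    (Λ c).part (a + (s c - s 0).toNat) ≤ (Λ 0).part a := by
  induction c using Fin.induction with
  | zero => simp
  | succ c ih =>
    have hstep := hcyl.1 c (a + (s c.castSucc - s 0).toNat) (by omega)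
    have h0 := hs.zero_le c.castSucc
    have h1 := (hs c.castSucc c.succ c.castSucc_lt_succ).1
    have hrow : a + (s c.castSucc - s 0).toNat + (s c.succ - s c.castSucc).toNat
        = a + (s c.succ - s 0).toNat := by omega
    rw [hrow] at hstep
    exact hstep.trans ih

theorem Cylindric.part_add_le_last {l e : ℕ} {s : Fin (l + 1) → ℤ} {Λ : MultiPartition l}
    (he : 0 < e) (hs : InSe e s) (hcyl : Cylindric e s Λ) (c : Fin (l + 1)) {a : ℕ}
    (ha : 1 ≤ a) :
    (Λ c).part (a + ((e : ℤ) + s c - s (Fin.last l)).toNat) ≤ (Λ (Fin.last l)).part a := by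
  have hstep := hcyl.part_add_le_zero hs c
    (a := a + ((e : ℤ) + s 0 - s (Fin.last l)).toNat) (by omega)
  have h0 := hs.zero_le c
  have h1 := hs.last_lt he
  have hrow : a + ((e : ℤ) + s 0 - s (Fin.last l)).toNat + (s c - s 0).toNat
      = a + ((e : ℤ) + s c - s (Fin.last l)).toNat := by omega
  rw [hrow] at hstep
  exact hstep.trans (hcyl.2 a ha)

/-- If the parts of maximal size `α` cover all residues, then their rightmost nodes realise
every one of the `e` largest possible contents. -/
theorem exists_rightmostAt_content_eq {l e : ℕ} {s : Fin (l + 1) → ℤ} {Λ : MultiPartition l}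
    {α : ℕ} (he : 0 < e) (hs : InSe e s) (hcyl : Cylindric e s Λ) (hcov : Covers e s Λ α)
    (hmax : ∀ (c : Fin (l + 1)) (a : ℕ), (Λ c).part a ≤ α) {x : ℤ}
    (hx : s (Fin.last l) - e ≤ x) (hx' : x < s (Fin.last l)) :
    ∃ γ, RightmostAt Λ α γ ∧ content s γ = α + x := by
  have he' : (0 : ℤ) < e := by exact_mod_cast he
  obtain ⟨⟨a, b, c⟩, ⟨ha, hb, hpart⟩, hmod⟩ :=
    hcov ((α + x) % e) (Int.emod_nonneg _ he'.ne') (Int.emod_lt_of_pos _ he')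
  dsimp only at ha hb hpart
  obtain ⟨k, hk⟩ := Int.ModEq.dvd (n := e) (a := α + x) hmod.symm
  have hlast := hs.le_last c
  have hk0 : k ≤ 0 := by
    by_contra! hk1
    have : (e : ℤ) * 1 ≤ e * k := by gcongr; omega
    simp only [content] at hk
    omega
  rcases hk0.eq_or_lt with rfl | hk1
  · exact ⟨⟨a, b, c⟩, ⟨ha, hb, hpart⟩, by linarith⟩
  have hshift : (e : ℤ) * k ≤ e * (-1) := by gcongr; omega
  have h0 := hs.zero_le c
  have h1 := hs.last_lt he
  simp only [content] at hk
  have hrow : 1 ≤ (s (Fin.last l) - x).toNat := by omega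
  have hge : α ≤ (Λ (Fin.last l)).part (s (Fin.last l) - x).toNat := by
    rw [← hpart]
    exact ((Λ c).part_le_of_le (by omega) (by omega)).trans
      (hcyl.part_add_le_last he hs c hrow)
  refine ⟨⟨(s (Fin.last l) - x).toNat, α, Fin.last l⟩,
    ⟨hrow, rfl, (hmax _ _).antisymm hge⟩, ?_⟩
  simp only [content]
  omega

theorem content_le_of_rightmostAt {l e : ℕ} {s : Fin (l + 1) → ℤ} {Λ : MultiPartition l}
    {α : ℕ} (hs : InSe e s) {γ : Node l} (hγ : RightmostAt Λ α γ) :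
    content s γ ≤ α + (s (Fin.last l) - 1) := by
  obtain ⟨hrow, hcol, -⟩ := hγ
  have h := hs.le_last γ.comp
  unfold content
  omega

theorem IsFirstPseudoperiod.content_eq {l e : ℕ} {s : Fin (l + 1) → ℤ} {Λ : MultiPartition l}
    {α : ℕ} {P : ℕ → Node l} (hs : InSe e s) (hcyl : Cylindric e s Λ)
    (hP : IsFirstPseudoperiod e s Λ α P)
    (hmax : ∀ (c : Fin (l + 1)) (a : ℕ), (Λ c).part a ≤ α) {i : ℕ} (hi : i < e) :
    content s (P i) = α + (s (Fin.last l) - 1 - i) := by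
  obtain ⟨-, hcov, -, hright, htop, -, hnext⟩ := hP
  obtain ⟨γ, hγ, hcont⟩ := exists_rightmostAt_content_eq (x := s (Fin.last l) - 1 - i)
    (by omega) hs hcyl hcov hmax (by omega) (by omega)
  induction i generalizing γ with
  | zero =>
    have h1 := content_le_of_rightmostAt hs (hright 0 hi)
    have h2 := htop γ hγ
    push_cast at *
    omega
  | succ i ih =>
    obtain ⟨δ, hδ, hδc⟩ := exists_rightmostAt_content_eq (x := s (Fin.last l) - 1 - i)
      (by omega) hs hcyl hcov hmax (by omega) (by omega)
    have hprev := ih (by omega) δ hδ hδc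
    obtain ⟨h1, h2, -⟩ := hnext i hi
    have h3 := h2 γ hγ (by push_cast at *; omega)
    push_cast at *
    omega

/-!
STATEMENT 13: if the width α of the first pseudoperiod of a cylindric non-FLOTW (λ, s)
equals the largest part of λ (so that the pseudoperiod is a period of the symbol), then
each of the e rightmost columns of the s-symbol of λ (of size p, the rightmost column
being column p + s_l) contains exactly one entry corresponding to a node of P(λ).
-/
theorem period_occupies_rightmost_columns
    (l e : ℕ) (he : 2 ≤ e) (s : Fin (l + 1) → ℤ) (Λ : MultiPartition l)
    (α : ℕ) (P : ℕ → Node l)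
    (hs : InSe e s) (hcyl : Cylindric e s Λ) (hnf : ¬ FLOTW e s Λ)
    (hP : IsFirstPseudoperiod e s Λ α P)
    (hmax : ∀ (c : Fin (l + 1)) (a : ℕ), (Λ c).part a ≤ α) :
    ∀ p : ℤ, SizeOK s Λ p →
      ∀ m : ℤ, p + s (Fin.last l) - e + 1 ≤ m → m ≤ p + s (Fin.last l) →
        ∃! i : ℕ, i < e ∧ colOf s p (P i) = m := by
  intro p _ m hm hm'
  have hcol : ∀ i, i < e → colOf s p (P i) = p + s (Fin.last l) - i := by
    intro i hi
    have hcontent := hP.content_eq hs hcyl hmax hi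
    have hwidth := (hP.2.2.2.1 i hi).2.1
    unfold content at hcontent
    unfold colOf
    omega
  refine ⟨(p + s (Fin.last l) - m).toNat, ⟨by omega, ?_⟩, ?_⟩
  · rw [hcol _ (by omega)]
    omega
  · rintro j ⟨hj, hjm⟩
    rw [hcol j hj] at hjm
    omega

end FockCrystal
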